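/- arXiv:1907.02914 — 2 statements merged into one kernel-verified Lean document; each statement's English description precedes it below -/
import Mathlib

section
/- Let K be a number field. For all X ≥ Y ≥ 2, Σ_{N(p) ≤ Y} Ψ(X/N(p), N(p)) ≤ [K:ℚ] · Ψ(X, Y), where the sum runs over all prime ideals p of O_K of norm at most Y. -/
open NumberField Ideal Filter

noncomputable section

namespace AlladiGen

variable (K : Type*) [Field K] [NumberField K]

open Classical in
/-- The generalized Möbius function on integral ideals. -/
def muK (a : Ideal (𝓞 K)) : ℤ :=
  if Squarefree a then (-1) ^ (Nat.card {p : Ideal (𝓞 K) // p.IsPrime ∧ a ≤ p}) else 0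

/-- `p` is a prime ideal of minimal norm among those containing `a`. -/
def MinimalPrime (a p : Ideal (𝓞 K)) : Prop :=
  p.IsPrime ∧ a ≤ p ∧ ∀ q : Ideal (𝓞 K), q.IsPrime → a ≤ q → absNorm p ≤ absNorm q

/-- `a ∈ D(K,S)`: `a` is distinguishable with minimal prime in `S`. -/
def InD (S : Set (Ideal (𝓞 K))) (a : Ideal (𝓞 K)) : Prop :=
  ∃ p : Ideal (𝓞 K), MinimalPrime K a p ∧ p ∈ S ∧ ∀ q : Ideal (𝓞 K), MinimalPrime K a q → q = p

/-- `π_S(K; X)`: number of prime ideals in `S` of norm at most `X`. -/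
def primeCount (S : Set (Ideal (𝓞 K))) (X : ℝ) : ℕ :=
  Nat.card {p : Ideal (𝓞 K) // p.IsPrime ∧ p ∈ S ∧ (absNorm p : ℝ) ≤ X}

/-- `S` has natural density `δ` within the prime ideals of `K`. -/
def HasPrimeDensity (S : Set (Ideal (𝓞 K))) (δ : ℝ) : Prop :=
  Tendsto (fun X : ℝ => (primeCount K S X : ℝ) / (primeCount K Set.univ X : ℝ))
    atTop (nhds δ)

/-- `M(a)`: the maximal norm of a prime ideal containing `a`. -/
def maxNorm (a : Ideal (𝓞 K)) : ℕ :=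
  sSup (absNorm '' {p : Ideal (𝓞 K) | p.IsPrime ∧ a ≤ p})

/-- `Q_S(a)`: number of primes in `S` containing `a` of maximal norm. -/
def QS (S : Set (Ideal (𝓞 K))) (a : Ideal (𝓞 K)) : ℕ :=
  Nat.card {p : Ideal (𝓞 K) // p.IsPrime ∧ a ≤ p ∧ p ∈ S ∧ absNorm p = maxNorm K a}

/-- `c_K`: residue of the Dedekind zeta function at 1, via the analytic class number formula. -/
def cK : ℝ :=
  (2 ^ (InfinitePlace.nrRealPlaces K) * (2 * Real.pi) ^ (InfinitePlace.nrComplexPlaces K) *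
    NumberField.Units.regulator K * (NumberField.classNumber K)) /
  ((NumberField.Units.torsionOrder K : ℝ) * Real.sqrt |(NumberField.discr K : ℝ)|)

/-- `Ψ(X,Y)`: number of `Y`-smooth nonzero integral ideals of norm at most `X`. -/
def Psi (X Y : ℝ) : ℕ :=
  Nat.card {a : Ideal (𝓞 K) // a ≠ ⊥ ∧ (absNorm a : ℝ) ≤ X ∧
    ∀ p : Ideal (𝓞 K), p.IsPrime → a ≤ p → (absNorm p : ℝ) ≤ Y}

/-- `[X]_K`: number of nonzero integral ideals of norm at most `X`. -/
def idealCount (X : ℝ) : ℕ := Nat.card {a : Ideal (𝓞 K) // a ≠ ⊥ ∧ (absNorm a : ℝ) ≤ X}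

/-- The logarithmic integral `Li(X) = ∫_2^X dt / log t`. -/
def Li (X : ℝ) : ℝ := ∫ t in (2:ℝ)..X, 1 / Real.log t


/-- Nonzero primes of the same norm: there are at most `[K:ℚ]` of them. -/
lemma card_primes_same_norm (s : Finset (Ideal (𝓞 K))) (q : ℕ)
    (hs : ∀ p ∈ s, p.IsPrime ∧ p ≠ ⊥ ∧ absNorm p = q) :
    s.card ≤ Module.finrank ℚ K := by
  classical
  rcases s.eq_empty_or_nonempty with rfl | ⟨P, hP⟩
  · simp
  obtain ⟨hPp, hP0, hPq⟩ := hs P hP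
  have hprime : ∀ p ∈ s, (absNorm (under ℤ p)).Prime := by
    intro p hp
    obtain ⟨h1, h2, _⟩ := hs p hp
    haveI : NeZero p := ⟨h2⟩
    exact Nat.absNorm_under_prime p
  set l := absNorm (under ℤ P) with hl
  have hlp : l.Prime := hprime P hP
  have hql : q = l ^ ((under ℤ P).inertiaDeg' P) := by
    rw [← hPq]
    refine absNorm_eq_pow_inertiaDeg'_of_liesOver P (under ℤ P) inferInstance ?_
    intro h
    rw [h] at hl
    simp at hl
    exact hlp.ne_zero hl
  have hlq : l ∣ q := hPq ▸ Int.absNorm_under_dvd_absNorm P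
  have hq0 : 0 < q := by rw [hql]; exact pow_pos hlp.pos _
  have hdvd : ∏ p ∈ s, p ∣ span {(l : 𝓞 K)} := by
    apply Finset.prod_primes_dvd
    · intro p hp
      obtain ⟨h1, h2, _⟩ := hs p hp
      exact prime_of_isPrime h2 h1
    · intro p hp
      have h := Int.absNorm_under_dvd_absNorm p
      rw [(hs p hp).2.2, hql] at h
      have h2 : absNorm (under ℤ p) = l :=
        (Nat.prime_dvd_prime_iff_eq (hprime p hp) hlp).1 ((hprime p hp).dvd_of_dvd_pow h)
      rw [dvd_span_singleton, ← h2]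
      exact Int.absNorm_under_mem p
  have hn := map_dvd absNorm hdvd
  rw [map_prod, Finset.prod_congr rfl (fun p hp => (hs p hp).2.2), Finset.prod_const,
    absNorm_span_natCast, RingOfIntegers.rank] at hn
  have h1 := (pow_dvd_pow_of_dvd hlq s.card).trans hn
  exact (Nat.pow_dvd_pow_iff_le_right hlp.one_lt).1 h1

lemma finite_psi (X Y : ℝ) : Finite {a : Ideal (𝓞 K) // a ≠ ⊥ ∧ (absNorm a : ℝ) ≤ X ∧
    ∀ p : Ideal (𝓞 K), p.IsPrime → a ≤ p → (absNorm p : ℝ) ≤ Y} := by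
  refine ((finite_setOfPred_absNorm_le (S := 𝓞 K) ⌊X⌋₊).subset ?_).to_subtype
  rintro a ⟨h1, h2, h3⟩
  exact Nat.le_floor h2

lemma finite_primes (Y : ℝ) :
    Finite {p : Ideal (𝓞 K) // p.IsPrime ∧ (absNorm p : ℝ) ≤ Y} := by
  refine ((finite_setOfPred_absNorm_le (S := 𝓞 K) ⌊Y⌋₊).subset ?_).to_subtype
  rintro a ⟨h1, h2⟩
  exact Nat.le_floor h2

lemma ne_bot_of_psi {X : ℝ} {p a : Ideal (𝓞 K)} (ha : a ≠ ⊥)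
    (h : (absNorm a : ℝ) ≤ X / (absNorm p : ℝ)) : p ≠ ⊥ := by
  rintro rfl
  simp at h
  exact ha (absNorm_eq_zero_iff.1 h)

/-- `∑_{N(p) ≤ Y} Ψ(X/N(p), N(p)) ≤ [K:ℚ] Ψ(X,Y)`. -/
theorem psi_sum_le (X Y : ℝ) (hY : 2 ≤ Y) (hXY : Y ≤ X) :
    ∑' p : {p : Ideal (𝓞 K) // p.IsPrime ∧ (absNorm p : ℝ) ≤ Y},
        (Psi K (X / (absNorm p.1 : ℝ)) (absNorm p.1 : ℝ) : ℝ) ≤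
      (Module.finrank ℚ K : ℝ) * (Psi K X Y : ℝ) := by
  classical
  haveI := finite_primes K Y
  letI : Fintype {p : Ideal (𝓞 K) // p.IsPrime ∧ (absNorm p : ℝ) ≤ Y} := Fintype.ofFinite _
  haveI := finite_psi K
  letI : ∀ X Y : ℝ, Fintype {a : Ideal (𝓞 K) // a ≠ ⊥ ∧ (absNorm a : ℝ) ≤ X ∧
    ∀ p : Ideal (𝓞 K), p.IsPrime → a ≤ p → (absNorm p : ℝ) ≤ Y} := fun X Y => Fintype.ofFinite _
  rw [tsum_fintype]
  simp only [Psi, Nat.card_eq_fintype_card]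
  rw [← Nat.cast_sum, ← Fintype.card_sigma]
  norm_cast
  let f : (Σ p : {p : Ideal (𝓞 K) // p.IsPrime ∧ (absNorm p : ℝ) ≤ Y},
      {a : Ideal (𝓞 K) // a ≠ ⊥ ∧ (absNorm a : ℝ) ≤ X / (absNorm p.1 : ℝ) ∧
        ∀ r : Ideal (𝓞 K), r.IsPrime → a ≤ r → (absNorm r : ℝ) ≤ (absNorm p.1 : ℝ)}) →
      {a : Ideal (𝓞 K) // a ≠ ⊥ ∧ (absNorm a : ℝ) ≤ X ∧
        ∀ p : Ideal (𝓞 K), p.IsPrime → a ≤ p → (absNorm p : ℝ) ≤ Y} := fun x =>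
    ⟨x.1.1 * x.2.1, by
      obtain ⟨⟨p, hp, hpY⟩, ⟨a, ha, haX, hap⟩⟩ := x
      have hp0 := ne_bot_of_psi K ha haX
      have hpos : (0 : ℝ) < absNorm p := by
        have : absNorm p ≠ 0 := by rwa [Ne, absNorm_eq_zero_iff]
        exact_mod_cast Nat.pos_of_ne_zero this
      refine ⟨mul_ne_zero hp0 ha, ?_, ?_⟩
      · rw [map_mul, Nat.cast_mul, mul_comm]
        exact (le_div_iff₀ hpos).1 haX
      · intro r hr hle
        rcases hr.mul_le.1 hle with h | h
        · rwa [← (hp.isMaximal hp0).eq_of_le hr.ne_top h]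
        · exact (hap r hr h).trans hpY⟩
  refine Finset.card_le_mul_card_image_of_maps_to (f := f) (s := Finset.univ) (t := Finset.univ)
    (fun _ _ => Finset.mem_univ _) _ ?_
  intro b _
  have hkey : ∀ x y, f x = f y → absNorm x.1.1 ≤ absNorm y.1.1 := by
    rintro ⟨⟨p, hp, hpY⟩, ⟨a, ha, haX, hap⟩⟩ ⟨⟨q, hq, hqY⟩, ⟨c, hc, hcX, hcq⟩⟩ h
    have h' : p * a = q * c := congrArg Subtype.val h
    have hle : q * c ≤ p := by rw [← h']; exact Ideal.le_of_dvd (Dvd.intro _ rfl)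
    rcases hp.mul_le.1 hle with h1 | h1
    · have := (hq.isMaximal (ne_bot_of_psi K hc hcX)).eq_of_le hp.ne_top h1
      exact (congrArg absNorm this).ge
    · exact_mod_cast hcq p hp h1
  rw [← Finset.card_image_of_injOn (f := fun x => x.1.1)]
  · rcases (Finset.univ.filter fun x => f x = b).eq_empty_or_nonempty with h | ⟨y, hy⟩
    · rw [h]; simp
    · apply card_primes_same_norm K _ (absNorm y.1.1)
      intro p hp
      obtain ⟨x, hx, rfl⟩ := Finset.mem_image.1 hp
      have hxy : f x = f y := (Finset.mem_filter.1 hx).2.trans (Finset.mem_filter.1 hy).2.symm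
      exact ⟨x.1.2.1, ne_bot_of_psi K x.2.2.1 x.2.2.2.1,
        le_antisymm (hkey x y hxy) (hkey y x hxy.symm)⟩
  · intro x hx y hy hxy
    have h : f x = f y := by
      simp only [Finset.coe_filter, Set.mem_ofPred_eq] at hx hy
      exact hx.2.trans hy.2.symm
    obtain ⟨⟨p, hp, hpY⟩, ⟨a, ha, haX, hap⟩⟩ := x
    obtain ⟨⟨q, hq, hqY⟩, ⟨c, hc, hcX, hcq⟩⟩ := y
    have h' : p * a = q * c := congrArg Subtype.val h
    obtain rfl : p = q := hxy
    obtain rfl : a = c := mul_left_cancel₀ (ne_bot_of_psi K ha haX) h'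
    rfl

end AlladiGen
end
end

section
/- Let K be a number field and c ⊆ O_K a nonzero squarefree integral ideal. Then φ(c, Y) := #{a ⊆ O_K nonzero integral ideal : N(a) ≤ Y and a is coprime to c} satisfies φ(c, Y) = c_K·Y·∏_{p ⊇ c} (1 − N(p)^{−1}) + O(Y^{1 − 1/[K:ℚ]}·N(c)), where the product runs over the prime ideals p containing c and the implied constant depends only on K. -/
open NumberField Ideal Filter

noncomputable section

namespace AlladiGen

variable (K : Type*) [Field K] [NumberField K]

section Geometry
open MeasureTheory Bornology Module
open scoped Pointwise

/-- Covering property: `B` is covered by `O(n^k)` balls of radius `O(1/n)`. -/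
def Cov {E : Type*} [PseudoMetricSpace E] (k : ℕ) (B : Set E) : Prop :=
  ∃ C : ℝ, 0 < C ∧ ∀ n : ℕ, 1 ≤ n → ∃ S : Finset E, (S.card : ℝ) ≤ C * (n : ℝ) ^ k ∧
    ∀ b ∈ B, ∃ s ∈ S, dist b s ≤ C / n

theorem Cov.mono {E : Type*} [PseudoMetricSpace E] {k : ℕ} {A B : Set E} (h : A ⊆ B)
    (hB : Cov k B) : Cov k A := by
  obtain ⟨C, hC, H⟩ := hB
  refine ⟨C, hC, fun n hn => ?_⟩
  obtain ⟨S, h1, h2⟩ := H n hn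
  exact ⟨S, h1, fun b hb => h2 b (h hb)⟩

theorem Cov.union {E : Type*} [PseudoMetricSpace E] {k : ℕ} {A B : Set E} (hA : Cov k A)
    (hB : Cov k B) : Cov k (A ∪ B) := by
  classical
  obtain ⟨C, hC, H⟩ := hA
  obtain ⟨C', hC', H'⟩ := hB
  refine ⟨C + C', by positivity, fun n hn => ?_⟩
  obtain ⟨S, h1, h2⟩ := H n hn
  obtain ⟨S', h1', h2'⟩ := H' n hn
  refine ⟨S ∪ S', ?_, ?_⟩
  · have : ((S ∪ S').card : ℝ) ≤ S.card + S'.card := by exact_mod_cast Finset.card_union_le _ _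
    linarith
  · have e1 : C / n ≤ (C + C') / n := by gcongr; linarith
    have e2 : C' / n ≤ (C + C') / n := by gcongr; linarith
    rintro b (hb | hb)
    · obtain ⟨s, hs, h⟩ := h2 b hb
      exact ⟨s, Finset.mem_union_left _ hs, h.trans e1⟩
    · obtain ⟨s, hs, h⟩ := h2' b hb
      exact ⟨s, Finset.mem_union_right _ hs, h.trans e2⟩

theorem Cov.empty {E : Type*} [PseudoMetricSpace E] (k : ℕ) : Cov k (∅ : Set E) :=
  ⟨1, one_pos, fun n _ => ⟨∅, by simp, by simp⟩⟩

theorem Cov.iUnion {E ι : Type*} [Finite ι] [PseudoMetricSpace E] {k : ℕ} {A : ι → Set E}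
    (hA : ∀ i, Cov k (A i)) : Cov k (⋃ i, A i) := by
  classical
  have := Fintype.ofFinite ι
  have key : ∀ s : Finset ι, Cov k (⋃ i ∈ s, A i) := by
    intro s
    induction s using Finset.induction_on with
    | empty => simpa using Cov.empty k
    | insert a s _ ih =>
      rw [Finset.set_biUnion_insert]
      exact (hA a).union ih
  simpa using key Finset.univ

theorem Cov.image {E F : Type*} [PseudoMetricSpace E] [PseudoMetricSpace F] {k : ℕ} {A : Set E}
    (hA : Cov k A) {f : E → F} {M : NNReal} (hf : LipschitzOnWith M f A) : Cov k (f '' A) := by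
  classical
  obtain ⟨C, hC, H⟩ := hA
  refine ⟨C + 2 * M * C, by positivity, fun n hn => ?_⟩
  obtain ⟨S, h1, h2⟩ := H n hn
  -- move the centers into `A`
  let g : E → F := fun s => if h : ∃ a ∈ A, dist a s ≤ C / n then f h.choose else f s
  refine ⟨S.image g, ?_, ?_⟩
  · have : ((S.image g).card : ℝ) ≤ S.card := by exact_mod_cast Finset.card_image_le
    have h3 : 0 ≤ 2 * M * C * (n : ℝ) ^ k := by positivity
    nlinarith
  · rintro _ ⟨a, ha, rfl⟩
    obtain ⟨s, hs, h⟩ := h2 a ha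
    refine ⟨g s, Finset.mem_image_of_mem _ hs, ?_⟩
    have hex : ∃ a ∈ A, dist a s ≤ C / n := ⟨a, ha, h⟩
    have hg : g s = f hex.choose := dif_pos hex
    rw [hg]
    have h4 := hex.choose_spec
    refine (hf.dist_le_mul a ha _ h4.1).trans ?_
    have h5 : dist a hex.choose ≤ 2 * (C / n) := by
      have := dist_triangle_right a hex.choose s
      linarith [h4.2]
    have h6 : 0 ≤ C / n := by positivity
    calc (M : ℝ) * dist a hex.choose ≤ M * (2 * (C / n)) := by gcongr
      _ ≤ C / n + M * (2 * (C / n)) := by linarith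
      _ = _ := by ring

theorem Cov.face {ι : Type*} [Fintype ι] (i : ι) (c : ℝ) :
    Cov (Fintype.card ι - 1) {x : ι → ℝ | (∀ j, x j ∈ Set.Icc (0:ℝ) 1) ∧ x i = c} := by
  classical
  refine ⟨2 ^ (Fintype.card ι - 1), by positivity, fun n hn => ?_⟩
  have hn0 : (0:ℝ) < n := by exact_mod_cast hn
  let S : ι → Finset ℝ := fun j => if j = i then {c} else
    (Finset.range (n + 1)).image (fun m : ℕ => (m : ℝ) / n)
  refine ⟨Fintype.piFinset S, ?_, ?_⟩
  · rw [Fintype.card_piFinset]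
    have h1 : ∏ j, (S j).card ≤ (n + 1) ^ (Fintype.card ι - 1) := by
      rw [← Finset.mul_prod_erase _ _ (Finset.mem_univ i)]
      have : (S i).card = 1 := by simp [S]
      rw [this, one_mul, ← Finset.card_univ, ← Finset.card_erase_of_mem (Finset.mem_univ i)]
      apply Finset.prod_le_pow_card
      intro j hj
      have hj' : j ≠ i := Finset.ne_of_mem_erase hj
      simp only [S, if_neg hj']
      exact Finset.card_image_le.trans (by simp)
    calc ((∏ j, (S j).card : ℕ) : ℝ) ≤ ((n + 1) ^ (Fintype.card ι - 1) : ℕ) := by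
          exact_mod_cast h1
      _ = ((n : ℝ) + 1) ^ (Fintype.card ι - 1) := by push_cast; rfl
      _ ≤ (2 * (n : ℝ)) ^ (Fintype.card ι - 1) := by
          gcongr
          have : (1:ℝ) ≤ n := by exact_mod_cast hn
          linarith
      _ = _ := by rw [mul_pow]
  · rintro x ⟨hx, hxi⟩
    refine ⟨fun j => if j = i then c else (⌊x j * n⌋₊ : ℝ) / n, ?_, ?_⟩
    · rw [Fintype.mem_piFinset]
      intro j
      by_cases hj : j = i
      · simp [S, hj]
      · simp only [S, if_neg hj, Finset.mem_image, Finset.mem_range]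
        refine ⟨_, ?_, rfl⟩
        rw [Nat.lt_succ_iff]
        apply Nat.floor_le_of_le
        have := (hx j).2
        nlinarith
    · have h1 : (1:ℝ) / n ≤ 2 ^ (Fintype.card ι - 1) / n := by
        gcongr
        exact one_le_pow₀ (by norm_num)
      refine le_trans ?_ h1
      rw [dist_pi_le_iff (by positivity)]
      intro j
      by_cases hj : j = i
      · subst hj; simp [hxi]
      · simp only [if_neg hj]
        have h0 : 0 ≤ x j * n := mul_nonneg (hx j).1 hn0.le
        have h2 := Nat.floor_le h0
        have h3 := Nat.lt_floor_add_one (x j * n)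
        have : x j - (⌊x j * n⌋₊ : ℝ) / n = (x j * n - ⌊x j * n⌋₊) / n := by field_simp
        rw [Real.dist_eq, this, abs_div, abs_of_pos hn0]
        gcongr
        rw [abs_le]; constructor <;> linarith

theorem segment_meets_frontier {E : Type*} [NormedAddCommGroup E] [NormedSpace ℝ E]
    {D : Set E} {x y : E} (h : (x ∈ D ∧ y ∉ D) ∨ (x ∉ D ∧ y ∈ D)) :
    ∃ z ∈ frontier D, dist x z ≤ dist x y := by
  have hs : IsPreconnected (segment ℝ x y) := (convex_segment x y).isPreconnected
  have : ∃ z ∈ segment ℝ x y, z ∈ frontier D := by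
    by_contra! hcon
    have hsub : segment ℝ x y ⊆ interior D ∪ (closure D)ᶜ := by
      intro z hz
      have := hcon z hz
      rw [frontier, Set.mem_sdiff, not_and_not_right] at this
      by_cases hc : z ∈ closure D
      · exact Or.inl (this hc)
      · exact Or.inr hc
    have hd : Disjoint (interior D) (closure D)ᶜ :=
      Set.disjoint_compl_right_iff_subset.mpr (interior_subset.trans subset_closure)
    have hx := left_mem_segment ℝ x y
    have hy := right_mem_segment ℝ x y
    rcases hs.subset_or_subset isOpen_interior isClosed_closure.isOpen_compl hd hsub with h1 | h1
    · have a := interior_subset (h1 hx)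
      have b := interior_subset (h1 hy)
      tauto
    · have a : x ∉ D := fun hh => h1 hx (subset_closure hh)
      have b : y ∉ D := fun hh => h1 hy (subset_closure hh)
      tauto
  obtain ⟨z, hz, hzf⟩ := this
  refine ⟨z, hzf, ?_⟩
  have := dist_add_dist_of_mem_segment hz
  linarith [dist_nonneg (x := z) (y := y)]

theorem count_lattice {E : Type*} [NormedAddCommGroup E] [NormedSpace ℝ E] [FiniteDimensional ℝ E]
    [MeasurableSpace E] [BorelSpace E] (μ : Measure E) [μ.IsAddHaarMeasure]
    (L : Submodule ℤ E) [DiscreteTopology L] [IsZLattice ℝ L] {D : Set E} (hb : IsBounded D)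
    (hcov : Cov (finrank ℝ E - 1) (frontier D)) :
    ∃ c C : ℝ, ∀ t : ℝ, 1 ≤ t →
      |(Nat.card ((t • D ∩ L : Set E)) : ℝ) - c * t ^ finrank ℝ E| ≤ C * t ^ (finrank ℝ E - 1) := by
  classical
  have : ProperSpace E := FiniteDimensional.proper_real E
  let b₀ := Module.Free.chooseBasis ℤ L
  let b := b₀.ofZLatticeBasis ℝ L
  have hL : Submodule.span ℤ (Set.range b) = L := b₀.ofZLatticeBasis_span ℝ L
  set F := ZSpan.fundamentalDomain b with hF
  set V := μ.real F with hV
  have hFb : IsBounded F := ZSpan.fundamentalDomain_isBounded b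
  have hFm : MeasurableSet F := ZSpan.fundamentalDomain_measurableSet b
  have hFfin : μ F ≠ ⊤ := hFb.measure_lt_top.ne
  have hV0 : 0 < V := ENNReal.toReal_pos (ZSpan.measure_fundamentalDomain_ne_zero b) hFfin
  obtain ⟨R, hR⟩ := isBounded_iff_forall_norm_le.mp hFb
  obtain ⟨C, hC, hcov⟩ := hcov
  set k := finrank ℝ E - 1 with hk
  set W := μ.real (Metric.closedBall (0:E) (C + R)) with hW
  refine ⟨μ.real D / V, C * 2 ^ k * W / V, fun t ht => ?_⟩
  have ht0 : 0 < t := by linarith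
  obtain ⟨S, hS1, hS2⟩ := hcov ⌈t⌉₊ (Nat.one_le_ceil_iff.mpr ht0)
  have hn0 : (0:ℝ) < ⌈t⌉₊ := by exact_mod_cast Nat.ceil_pos.mpr ht0
  have hn1 : t ≤ ⌈t⌉₊ := Nat.le_ceil t
  have hn2 : (⌈t⌉₊ : ℝ) ≤ 2 * t := by
    have := Nat.ceil_lt_add_one ht0.le
    linarith
  set N : Set E := ⋃ s ∈ S, Metric.closedBall (t • s) (C + R) with hN
  have hNfin : μ N ≠ ⊤ := by
    apply ne_of_lt
    refine (measure_biUnion_finset_le _ _).trans_lt ?_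
    exact ENNReal.sum_lt_top.mpr fun s _ => measure_closedBall_lt_top
  have hNle : μ.real N ≤ C * 2 ^ k * W * t ^ k := by
    calc μ.real N ≤ ∑ s ∈ S, μ.real (Metric.closedBall (t • s) (C + R)) :=
          measureReal_biUnion_finset_le _ _
      _ = S.card * W := by
          rw [← nsmul_eq_mul, ← Finset.sum_const]
          refine Finset.sum_congr rfl fun s _ => ?_
          simp only [hW, measureReal_def, Measure.addHaar_closedBall_center]
      _ ≤ (C * (2 * t) ^ k) * W := by
          gcongr
          exact hS1.trans (by gcongr)
      _ = _ := by rw [mul_pow]; ring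
  -- the key geometric fact
  have key : ∀ x l : E, x - l ∈ F → ((x ∈ t • D ∧ l ∉ t • D) ∨ (x ∉ t • D ∧ l ∈ t • D)) →
      x ∈ N := by
    intro x l hxl hor
    simp only [Set.mem_smul_set_iff_inv_smul_mem₀ ht0.ne'] at hor
    obtain ⟨z, hz, hd⟩ := segment_meets_frontier hor
    obtain ⟨s, hs, hds⟩ := hS2 z hz
    refine Set.mem_biUnion hs ?_
    rw [Metric.mem_closedBall]
    have h1 : dist x (t • z) ≤ R := by
      have : dist x (t • z) = t * dist (t⁻¹ • x) z := by
        conv_lhs => rw [← smul_inv_smul₀ ht0.ne' x, dist_smul₀, Real.norm_of_nonneg ht0.le]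
      rw [this]
      have h2 : t * dist (t⁻¹ • x) (t⁻¹ • l) = dist x l := by
        rw [dist_smul₀, Real.norm_of_nonneg (by positivity), mul_inv_cancel_left₀ ht0.ne']
      have h3 : dist x l ≤ R := by rw [dist_eq_norm]; exact hR _ hxl
      have := mul_le_mul_of_nonneg_left hd ht0.le
      linarith
    have h2 : dist (t • z) (t • s) ≤ C := by
      rw [dist_smul₀, Real.norm_of_nonneg ht0.le]
      calc t * dist z s ≤ t * (C / ⌈t⌉₊) := by gcongr
        _ ≤ ⌈t⌉₊ * (C / ⌈t⌉₊) := by gcongr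
        _ = C := by field_simp
    linarith [dist_triangle x (t • z) (t • s)]
  have hAfin : (t • D ∩ L : Set E).Finite := by
    rw [← hL]
    exact ZSpan.setFinite_inter b (hb.smul₀ t)
  set A := hAfin.toFinset with hA
  have hcard : Nat.card ((t • D ∩ L : Set E)) = A.card := by
    rw [Nat.card_coe_set_eq, Set.ncard_eq_toFinset_card _ hAfin]
  set U : Set E := ⋃ l ∈ A, (fun x => l + x) '' F with hU
  have himg : ∀ l : E, (fun x => l + x) '' F = {x | x - l ∈ F} := by
    intro l
    ext x
    constructor
    · rintro ⟨y, hy, rfl⟩; simpa using hy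
    · intro h; exact ⟨x - l, h, by simp⟩
  have hmeasl : ∀ l : E, μ ((fun x => l + x) '' F) = μ F := fun l => by
    rw [Set.image_add_left, measure_preimage_add]
  have hUm : μ.real U = A.card * V := by
    rw [hU, measureReal_biUnion_finset (h := fun l _ => by rw [hmeasl]; exact hFfin)]
    · simp only [measureReal_def, hmeasl, Finset.sum_const, nsmul_eq_mul, hV]
    · intro l hl l' hl' hne
      rw [Function.onFun, Set.disjoint_left]
      intro x hx hx'
      rw [himg] at hx hx'
      apply hne
      have hl1 : l ∈ Submodule.span ℤ (Set.range b) := by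
        rw [hL]; exact ((Set.Finite.mem_toFinset _).mp hl).2
      have hl2 : l' ∈ Submodule.span ℤ (Set.range b) := by
        rw [hL]; exact ((Set.Finite.mem_toFinset _).mp hl').2
      have e1 := (ZSpan.fract_eq_self (b := b)).mpr hx
      have e2 := (ZSpan.fract_eq_self (b := b)).mpr hx'
      have e3 : ZSpan.fract b (x - l) = ZSpan.fract b x := by
        rw [sub_eq_add_neg]; exact ZSpan.fract_add_ZSpan b x (neg_mem hl1)
      have e4 : ZSpan.fract b (x - l') = ZSpan.fract b x := by
        rw [sub_eq_add_neg]; exact ZSpan.fract_add_ZSpan b x (neg_mem hl2)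
      have : x - l = x - l' := by rw [← e1, ← e2, e3, e4]
      simpa using this
    · intro l _
      rw [Set.image_add_left]
      exact (measurable_const_add _) hFm
  have hUfin : μ U ≠ ⊤ := by
    apply ne_of_lt
    refine (measure_biUnion_finset_le _ _).trans_lt ?_
    exact ENNReal.sum_lt_top.mpr fun s _ => by rw [hmeasl]; exact hFfin.lt_top
  have hDfin : μ (t • D) ≠ ⊤ := (hb.smul₀ t).measure_lt_top.ne
  have hsub1 : U ⊆ t • D ∪ N := by
    intro x hx
    simp only [hU, Set.mem_iUnion] at hx
    obtain ⟨l, hl, hxl⟩ := hx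
    rw [himg] at hxl
    have hlD : l ∈ t • D := ((Set.Finite.mem_toFinset _).mp hl).1
    by_cases hxD : x ∈ t • D
    · exact Or.inl hxD
    · exact Or.inr (key x l hxl (Or.inr ⟨hxD, hlD⟩))
  have hsub2 : t • D ⊆ U ∪ N := by
    intro x hx
    set l : E := ((ZSpan.floor b x : Submodule.span ℤ (Set.range b)) : E) with hl
    have hxl : x - l ∈ F := ZSpan.fract_mem_fundamentalDomain b x
    by_cases hlD : l ∈ t • D
    · left
      simp only [hU, Set.mem_iUnion]
      refine ⟨l, (Set.Finite.mem_toFinset _).mpr ⟨hlD, ?_⟩, ?_⟩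
      · exact hL.le (ZSpan.floor b x).2
      · rw [himg]; exact hxl
    · exact Or.inr (key x l hxl (Or.inl ⟨hx, hlD⟩))
  have hDvol : μ.real (t • D) = t ^ finrank ℝ E * μ.real D := by
    rw [measureReal_def, Measure.addHaar_smul, ENNReal.toReal_mul, abs_of_pos (by positivity),
      ENNReal.toReal_ofReal (by positivity), measureReal_def]
  have i1 : μ.real U ≤ μ.real (t • D) + μ.real N :=
    (measureReal_mono hsub1 (measure_union_ne_top hDfin hNfin)).trans (measureReal_union_le _ _)
  have i2 : μ.real (t • D) ≤ μ.real U + μ.real N :=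
    (measureReal_mono hsub2 (measure_union_ne_top hUfin hNfin)).trans (measureReal_union_le _ _)
  rw [hUm, hDvol] at i1 i2
  rw [hcard]
  have : (A.card : ℝ) - μ.real D / V * t ^ finrank ℝ E =
      (A.card * V - t ^ finrank ℝ E * μ.real D) / V := by field_simp
  rw [this, abs_div, abs_of_pos hV0, div_mul_eq_mul_div]
  gcongr
  rw [abs_le]
  constructor <;> linarith

end Geometry

section Frontier
open NumberField.InfinitePlace NumberField.mixedEmbedding NumberField.mixedEmbedding.fundamentalCone
  NumberField.Units NumberField.Units.dirichletUnitTheorem Module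

open Classical in
/-- Parametrization of the moduli part of the fundamental domain. -/
def psi (p : InfinitePlace K → ℝ) : realSpace K :=
  p w₀ • expMapBasis (fun i ↦ if i = w₀ then 0 else p i)

theorem contDiff_expMapBasis : ContDiff ℝ 1 (fun x : realSpace K => (expMapBasis x : realSpace K)) := by
  classical
  have : (fun x : realSpace K => (expMapBasis x : realSpace K)) =
    fun x w => Real.exp ((w.mult : ℝ)⁻¹ * ((completeBasis K).equivFunL.symm x) w) := by
    ext x w
    rw [expMapBasis_apply, expMap_apply]
    rfl
  rw [this, contDiff_pi]
  intro w
  apply Real.contDiff_exp.comp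
  apply contDiff_const.mul
  exact (contDiff_apply ℝ ℝ w).comp (ContinuousLinearEquiv.contDiff _)

theorem contDiff_psi : ContDiff ℝ 1 (psi K) := by
  classical
  unfold psi
  refine (contDiff_apply ℝ ℝ w₀).smul ((contDiff_expMapBasis K).comp ?_)
  rw [contDiff_pi]
  intro i
  by_cases h : i = w₀
  · simp [h, contDiff_const]
  · simp only [if_neg h]
    exact contDiff_apply ℝ ℝ i

/-- Parametrization of the closure of `normLeOne` for given signs. -/
def Phi (s : {w : InfinitePlace K // IsReal w} → Bool)
    (p : InfinitePlace K ⊕ {w : InfinitePlace K // IsComplex w} → ℝ) : mixedSpace K :=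
  (fun w => (if s w then (1:ℝ) else -1) * psi K (fun i => p (Sum.inl i)) w.1,
   fun w => Complex.exp (((2 * Real.pi * p (Sum.inr w) : ℝ) : ℂ) * Complex.I) *
    ((psi K (fun i => p (Sum.inl i)) w.1 : ℝ) : ℂ))

open scoped Classical in
theorem contDiff_Phi (s : {w : InfinitePlace K // IsReal w} → Bool) : ContDiff ℝ 1 (Phi K s) := by
  have h0 : ContDiff ℝ 1 (fun p : InfinitePlace K ⊕ {w : InfinitePlace K // IsComplex w} → ℝ =>
      psi K (fun i => p (Sum.inl i))) := by
    refine (contDiff_psi K).comp ?_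
    rw [contDiff_pi]
    intro i
    exact contDiff_apply ℝ ℝ _
  unfold Phi
  refine ContDiff.prodMk ?_ ?_
  · rw [contDiff_pi]
    intro w
    exact contDiff_const.mul ((contDiff_apply ℝ ℝ w.1).comp h0)
  · rw [contDiff_pi]
    intro w
    refine ContDiff.mul ?_ (Complex.ofRealCLM.contDiff.comp ((contDiff_apply ℝ ℝ w.1).comp h0))
    refine ContDiff.cexp ?_
    refine ContDiff.mul ?_ contDiff_const
    exact Complex.ofRealCLM.contDiff.comp (contDiff_const.mul (contDiff_apply ℝ ℝ _))

theorem exists_angle (z : ℂ) : ∃ θ ∈ Set.Icc (0:ℝ) 1,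
    z = Complex.exp (((2 * Real.pi * θ : ℝ) : ℂ) * Complex.I) * ((‖z‖ : ℝ) : ℂ) := by
  have hz := Complex.norm_mul_exp_arg_mul_I z
  have hpi := Real.pi_pos
  have h1 := Complex.neg_pi_lt_arg z
  have h2 := Complex.arg_le_pi z
  by_cases h : 0 ≤ Complex.arg z
  · refine ⟨Complex.arg z / (2 * Real.pi), ⟨by positivity, ?_⟩, ?_⟩
    · rw [div_le_one (by positivity)]; linarith
    · rw [mul_div_cancel₀ _ (by positivity), mul_comm, hz]
  · refine ⟨Complex.arg z / (2 * Real.pi) + 1, ⟨?_, ?_⟩, ?_⟩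
    · rw [div_add_one (by positivity)]
      apply div_nonneg <;> linarith
    · have : Complex.arg z / (2 * Real.pi) ≤ 0 :=
        div_nonpos_of_nonpos_of_nonneg (by linarith) (by positivity)
      linarith
    · rw [mul_add, mul_div_cancel₀ _ (by positivity), mul_one]
      have : (((Complex.arg z + 2 * Real.pi : ℝ) : ℂ) * Complex.I) =
        (Complex.arg z : ℂ) * Complex.I + 2 * Real.pi * Complex.I := by push_cast; ring
      rw [this, Complex.exp_periodic, mul_comm, hz]

theorem exists_Phi (x : mixedSpace K) (p : InfinitePlace K → ℝ) (h : normAtAllPlaces x = psi K p) :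
    ∃ s, ∃ q : InfinitePlace K ⊕ {w : InfinitePlace K // IsComplex w} → ℝ,
      (∀ i, q (Sum.inl i) = p i) ∧ (∀ w, q (Sum.inr w) ∈ Set.Icc (0:ℝ) 1) ∧ Phi K s q = x := by
  classical
  choose θ hθ1 hθ2 using exists_angle
  refine ⟨fun w => decide (0 ≤ x.1 w), Sum.elim p (fun w => θ (x.2 w)), fun i => rfl,
    fun w => hθ1 _, ?_⟩
  ext w
  · have := congrFun h w.1
    rw [normAtAllPlaces_apply, normAtPlace_apply_of_isReal w.2] at this
    simp only [Phi, Sum.elim_inl]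
    rw [← this]
    by_cases h0 : 0 ≤ x.1 w
    · simp [h0, abs_of_nonneg h0]
    · simp [h0, abs_of_neg (not_le.mp h0)]
  · have := congrFun h w.1
    rw [normAtAllPlaces_apply, normAtPlace_apply_of_isComplex w.2] at this
    simp only [Phi, Sum.elim_inl, Sum.elim_inr]
    rw [← this]
    exact (hθ2 _).symm

open scoped Classical in
theorem card_param : Fintype.card (InfinitePlace K ⊕ {w : InfinitePlace K // IsComplex w}) =
    finrank ℚ K := by
  rw [Fintype.card_sum, ← card_add_two_mul_card_eq_rank, nrComplexPlaces,
    InfinitePlace.card_eq_nrRealPlaces_add_nrComplexPlaces, nrComplexPlaces]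
  ring

theorem frontier_subset : frontier (normLeOne K) ⊆
    ⋃ s : {w : InfinitePlace K // IsReal w} → Bool, ⋃ i : InfinitePlace K, ⋃ e : Bool,
      Phi K s '' {x | (∀ j, x j ∈ Set.Icc (0:ℝ) 1) ∧ x (Sum.inl i) = if e then 1 else 0} := by
  classical
  rintro x ⟨hx1, hx2⟩
  have h1 := closure_normLeOne_subset K hx1
  have h2 : normAtAllPlaces x ∉ expMapBasis '' interior (paramSet K) :=
    fun h => hx2 (subset_interior_normLeOne K h)
  obtain ⟨t, ht, _, ⟨y, hy, rfl⟩, hty⟩ := h1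
  let p : InfinitePlace K → ℝ := fun i => if i = w₀ then t else y i
  have hp01 : ∀ i, p i ∈ Set.Icc (0:ℝ) 1 := by
    intro i
    by_cases hi : i = w₀
    · simpa only [p, if_pos hi] using ht
    · have := hy i (Set.mem_univ _)
      simp only [if_neg hi] at this
      simpa only [p, if_neg hi] using this
  have hyp : (fun i ↦ if i = w₀ then 0 else p i) = y := by
    ext i
    by_cases hi : i = w₀
    · have := hy i (Set.mem_univ _)
      simp only [if_pos hi, Set.mem_singleton_iff] at this
      rw [if_pos hi, this]
    · simp [p, hi]
  have hpsi : normAtAllPlaces x = psi K p := by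
    rw [psi, hyp, ← hty]
    simp [p]
  obtain ⟨s, q, hq1, hq2, hq3⟩ := exists_Phi K x p hpsi
  have hq01 : ∀ j, q j ∈ Set.Icc (0:ℝ) 1 := by
    rintro (i | w)
    · rw [hq1]; exact hp01 i
    · exact hq2 w
  have hface : ∃ i, p i = 0 ∨ p i = 1 := by
    by_contra! hcon
    have hoo : ∀ i, p i ∈ Set.Ioo (0:ℝ) 1 := fun i =>
      ⟨lt_of_le_of_ne (hp01 i).1 (hcon i).1.symm, lt_of_le_of_ne (hp01 i).2 (hcon i).2⟩
    have htoo : t ∈ Set.Ioo (0:ℝ) 1 := by simpa [p] using hoo w₀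
    apply h2
    refine ⟨fun i => if i = w₀ then Real.log t else p i, ?_, ?_⟩
    · rw [interior_paramSet, Set.mem_univ_pi]
      intro w
      by_cases hw : w = w₀
      · simp only [if_pos hw]
        exact Real.log_neg htoo.1 htoo.2
      · simp only [if_neg hw]
        exact hoo w
    · rw [expMapBasis_apply'', if_pos rfl, Real.exp_log htoo.1, hpsi, psi]
      congr 1
      · simp [p]
      · congr 1
        ext i
        by_cases hi : i = w₀ <;> simp [hi]
  obtain ⟨i, hi⟩ := hface
  simp only [Set.mem_iUnion]
  rcases hi with hi | hi
  · exact ⟨s, i, false, q, ⟨hq01, by simp [hq1, hi]⟩, hq3⟩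
  · exact ⟨s, i, true, q, ⟨hq01, by simp [hq1, hi]⟩, hq3⟩

open scoped Classical in
theorem cov_frontier : Cov (finrank ℚ K - 1) (frontier (normLeOne K)) := by
  refine Cov.mono (frontier_subset K) ?_
  refine Cov.iUnion fun s => Cov.iUnion fun i => Cov.iUnion fun e => ?_
  rw [← card_param K]
  have hcomp : IsCompact (Set.univ.pi fun _ :
      InfinitePlace K ⊕ {w : InfinitePlace K // IsComplex w} => Set.Icc (0:ℝ) 1) :=
    isCompact_univ_pi fun _ => isCompact_Icc
  obtain ⟨M, hM⟩ := LocallyLipschitzOn.exists_lipschitzOnWith_of_compact hcomp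
    ((contDiff_Phi K s).locallyLipschitz.locallyLipschitzOn (s := _))
  refine (Cov.face _ _).image (hM.mono ?_)
  rintro x ⟨hx, -⟩
  exact Set.mem_univ_pi.mpr hx

end Frontier

section Count
open NumberField.InfinitePlace NumberField.mixedEmbedding NumberField.mixedEmbedding.fundamentalCone
  NumberField.Units Module
open scoped nonZeroDivisors Pointwise

theorem card_class_eq {C : ClassGroup (𝓞 K)} {J : (Ideal (𝓞 K))⁰} {s : ℝ}
    (hJ : ClassGroup.mk0 J = C⁻¹) :
    Nat.card {I : (Ideal (𝓞 K))⁰ // absNorm (I : Ideal (𝓞 K)) ≤ s ∧ ClassGroup.mk0 I = C}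
      = Nat.card {I : (Ideal (𝓞 K))⁰ // (J : Ideal (𝓞 K)) ∣ I ∧
        Submodule.IsPrincipal (I : Ideal (𝓞 K)) ∧
        absNorm (I : Ideal (𝓞 K)) ≤ s * absNorm (J : Ideal (𝓞 K))} := by
  simp_rw [← nonZeroDivisors_dvd_iff_dvd_coe]
  refine Nat.card_congr ?_
  refine ((Equiv.dvd J).subtypeEquiv fun I ↦ ?_).trans
    (Equiv.subtypeSubtypeEquivSubtypeInter (fun I : (Ideal (𝓞 K))⁰ ↦ J ∣ I) _)
  rw [← ClassGroup.mk0_eq_one_iff (SetLike.coe_mem _)]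
  simp_rw [Equiv.dvd_apply, Submonoid.coe_mul, ← Submonoid.mul_def, _root_.map_mul, hJ,
    inv_mul_eq_one, Nat.cast_mul, mul_comm s, eq_comm, and_comm, and_congr_left_iff]
  exact fun _ ↦
    (mul_le_mul_iff_of_pos_left (Nat.cast_pos.mpr (absNorm_pos_of_nonZeroDivisors J))).symm

theorem card_cone_eq (J : (Ideal (𝓞 K))⁰) (t : ℝ) (ht : 0 < t) :
    Nat.card (t • normLeOne K ∩
      (idealLattice K (FractionalIdeal.mk0 K J) : Set (mixedSpace K)) : Set (mixedSpace K)) =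
    Nat.card {a : idealSet K J // mixedEmbedding.norm (a : mixedSpace K) ≤ t ^ finrank ℚ K} := by
  refine Nat.card_congr ((Equiv.subtypeEquivProp ?_).trans
    (Equiv.subtypeSubtypeEquivSubtypeInter _
      (fun x : mixedSpace K => mixedEmbedding.norm x ≤ t ^ finrank ℚ K)).symm)
  ext x
  have h1 : x ∈ t • normLeOne K ↔ x ∈ fundamentalCone K ∧
      mixedEmbedding.norm x ≤ t ^ finrank ℚ K := by
    rw [Set.mem_smul_set_iff_inv_smul_mem₀ ht.ne', mem_normLeOne,
      smul_mem_iff_mem (inv_ne_zero ht.ne'), mixedEmbedding.norm_smul, abs_of_pos (by positivity),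
      inv_pow, inv_mul_le_iff₀ (by positivity), mul_one]
  have h2 : x ∈ (idealLattice K (FractionalIdeal.mk0 K J) : Set (mixedSpace K)) ↔
      ∃ a : 𝓞 K, a ∈ (J : Ideal (𝓞 K)) ∧ mixedEmbedding K (a : K) = x := by
    rw [SetLike.mem_coe, mem_idealLattice, FractionalIdeal.coe_mk0]
    constructor
    · rintro ⟨_, ⟨a, ha, rfl⟩, rfl⟩
      exact ⟨a, ha, rfl⟩
    · rintro ⟨a, ha, rfl⟩
      exact ⟨_, ⟨a, ha, rfl⟩, rfl⟩
  change (x ∈ _ ∩ _) ↔ x ∈ idealSet K J ∧ _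
  rw [Set.mem_inter_iff, h1, h2, mem_idealSet]
  tauto

theorem class_count (C : ClassGroup (𝓞 K)) : ∃ c B : ℝ, ∀ s : ℝ, 1 ≤ s →
    |(Nat.card {I : (Ideal (𝓞 K))⁰ // absNorm (I : Ideal (𝓞 K)) ≤ s ∧ ClassGroup.mk0 I = C} : ℝ)
      - c * s| ≤ B * s ^ (1 - 1 / (finrank ℚ K : ℝ)) := by
  classical
  obtain ⟨J, hJ⟩ := ClassGroup.mk0_surjective C⁻¹
  have hNpos : (0:ℝ) < absNorm J.1 := Nat.cast_pos.mpr (absNorm_pos_of_nonZeroDivisors J)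
  have hN1 : (1:ℝ) ≤ absNorm J.1 := by
    exact_mod_cast Nat.one_le_iff_ne_zero.mpr (absNorm_pos_of_nonZeroDivisors J).ne'
  have hd : 0 < finrank ℚ K := finrank_pos
  have hd0 : (finrank ℚ K : ℝ) ≠ 0 := by exact_mod_cast hd.ne'
  obtain ⟨c, B, H⟩ := count_lattice MeasureTheory.volume
    (idealLattice K (FractionalIdeal.mk0 K J)) (isBounded_normLeOne K)
    (by rw [mixedEmbedding.finrank]; exact cov_frontier K)
  rw [mixedEmbedding.finrank] at H
  set T : ℝ := ((torsionOrder K : ℕ) : ℝ) with hT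
  have hT0 : 0 < T := Nat.cast_pos.mpr (torsionOrder_pos K)
  set N : ℝ := ((absNorm J.1 : ℕ) : ℝ) with hN
  refine ⟨c * N / T, B * N ^ (1 - 1 / (finrank ℚ K : ℝ)) / T, fun s hs => ?_⟩
  have hs0 : 0 < s := by linarith
  have hsN : 1 ≤ s * N := by nlinarith
  set t := (s * N) ^ (1 / (finrank ℚ K : ℝ)) with ht
  have ht1 : 1 ≤ t := Real.one_le_rpow hsN (by positivity)
  have htd : t ^ finrank ℚ K = s * N := by
    rw [ht, ← Real.rpow_natCast, ← Real.rpow_mul (by positivity), one_div_mul_cancel hd0,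
      Real.rpow_one]
  have htd1 : t ^ (finrank ℚ K - 1) = (s * N) ^ (1 - 1 / (finrank ℚ K : ℝ)) := by
    rw [ht, ← Real.rpow_natCast, ← Real.rpow_mul (by positivity), Nat.cast_sub hd]
    congr 1
    field_simp
    simp
  have := H t ht1
  rw [card_cone_eq K J t (by linarith), htd, htd1, ← card_isPrincipal_dvd_norm_le,
    ← card_class_eq K hJ, Nat.cast_mul, Real.mul_rpow hs0.le hNpos.le] at this
  rw [← hT] at this
  set X : ℝ := (Nat.card {I : (Ideal (𝓞 K))⁰ // (absNorm (I : Ideal (𝓞 K)) : ℝ) ≤ s ∧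
    ClassGroup.mk0 I = C} : ℝ) with hX
  have e : X - c * N / T * s = (X * T - c * (s * N)) / T := by field_simp
  rw [e, abs_div, abs_of_pos hT0, div_le_iff₀ hT0]
  refine this.trans (le_of_eq ?_)
  field_simp

theorem total_count₀ : ∃ c B : ℝ, ∀ s : ℝ, 1 ≤ s →
    |(Nat.card {I : (Ideal (𝓞 K))⁰ // absNorm (I : Ideal (𝓞 K)) ≤ s} : ℝ)
      - c * s| ≤ B * s ^ (1 - 1 / (finrank ℚ K : ℝ)) := by
  classical
  choose c B H using class_count K
  refine ⟨∑ C, c C, ∑ C, B C, fun s hs => ?_⟩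
  have hs0 : 0 ≤ s := by linarith
  have : (Nat.card {I : (Ideal (𝓞 K))⁰ // absNorm (I : Ideal (𝓞 K)) ≤ s} : ℝ) =
      ∑ C, (Nat.card {I : (Ideal (𝓞 K))⁰ // absNorm (I : Ideal (𝓞 K)) ≤ s ∧
        ClassGroup.mk0 I = C} : ℝ) := by
    have : Fintype {I : (Ideal (𝓞 K))⁰ // absNorm (I : Ideal (𝓞 K)) ≤ s} := by
      simp_rw [← Nat.le_floor_iff hs0]
      refine @Fintype.ofFinite _ (finite_setOfPred_absNorm_le₀ ⌊s⌋₊)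
    let e := fun C : ClassGroup (𝓞 K) ↦ Equiv.subtypeSubtypeEquivSubtypeInter
      (fun I : (Ideal (𝓞 K))⁰ ↦ absNorm I.1 ≤ s) (fun I ↦ ClassGroup.mk0 I = C)
    simp_rw [← Nat.card_congr (e _), Nat.card_eq_fintype_card, Fintype.subtype_card]
    rw [Fintype.card, Finset.card_eq_sum_card_fiberwise (f := fun I ↦ ClassGroup.mk0 I.1)
      (t := Finset.univ) (fun _ _ ↦ Finset.mem_univ _), Nat.cast_sum]
  rw [this, Finset.sum_mul, Finset.sum_mul, ← Finset.sum_sub_distrib]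
  exact (Finset.abs_sum_le_sum_abs _ _).trans (Finset.sum_le_sum fun C _ => H C s hs)

theorem total_count₁ : ∃ B : ℝ, ∀ s : ℝ, 1 ≤ s →
    |(Nat.card {I : (Ideal (𝓞 K))⁰ // absNorm (I : Ideal (𝓞 K)) ≤ s} : ℝ)
      - cK K * s| ≤ B * s ^ (1 - 1 / (finrank ℚ K : ℝ)) := by
  obtain ⟨c, B, H⟩ := total_count₀ K
  have hd : (0:ℝ) < finrank ℚ K := by exact_mod_cast (finrank_pos : 0 < finrank ℚ K)
  have hlim := NumberField.Ideal.tendsto_norm_le_div_atTop₀ K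
  have hlim2 : Tendsto (fun s : ℝ ↦
      (Nat.card {I : (Ideal (𝓞 K))⁰ // absNorm (I : Ideal (𝓞 K)) ≤ s} : ℝ) / s) atTop
      (nhds c) := by
    rw [tendsto_iff_dist_tendsto_zero]
    have h0 : Tendsto (fun s : ℝ => B * s ^ (-(1 / (finrank ℚ K : ℝ)))) atTop (nhds 0) := by
      simpa using (tendsto_rpow_neg_atTop (y := 1 / (finrank ℚ K : ℝ)) (by positivity)).const_mul B
    refine squeeze_zero' (Eventually.of_forall fun _ => dist_nonneg) ?_ h0
    filter_upwards [eventually_ge_atTop 1] with s hs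
    have hs0 : 0 < s := by linarith
    have h1 := H s hs
    rw [Real.dist_eq, div_sub' hs0.ne', abs_div, abs_of_pos hs0, div_le_iff₀ hs0, mul_assoc,
      ← Real.rpow_add_one hs0.ne', mul_comm s c]
    rw [show -(1 / (finrank ℚ K : ℝ)) + 1 = 1 - 1 / (finrank ℚ K : ℝ) by ring]
    exact h1
  have : c = cK K := tendsto_nhds_unique hlim2 hlim
  exact ⟨B, this ▸ H⟩

theorem total_count : ∃ B : ℝ, 0 < B ∧ ∀ s : ℝ, 0 < s →
    |(Nat.card {I : Ideal (𝓞 K) // I ≠ ⊥ ∧ (absNorm I : ℝ) ≤ s} : ℝ)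
      - cK K * s| ≤ B * s ^ (1 - 1 / (finrank ℚ K : ℝ)) := by
  obtain ⟨B, H⟩ := total_count₁ K
  have hd : (0:ℝ) < finrank ℚ K := by exact_mod_cast (finrank_pos : 0 < finrank ℚ K)
  refine ⟨|B| + |cK K| + 1, by positivity, fun s hs => ?_⟩
  have hpos : 0 ≤ s ^ (1 - 1 / (finrank ℚ K : ℝ)) := by positivity
  rcases le_or_gt 1 s with h1 | h1
  · have e : Nat.card {I : Ideal (𝓞 K) // I ≠ ⊥ ∧ (absNorm I : ℝ) ≤ s} =
        Nat.card {I : (Ideal (𝓞 K))⁰ // absNorm (I : Ideal (𝓞 K)) ≤ s} := by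
      refine Nat.card_congr ((Equiv.subtypeEquivRight fun I => ?_).trans
        (Equiv.subtypeSubtypeEquivSubtypeInter (fun I : Ideal (𝓞 K) => I ∈ (Ideal (𝓞 K))⁰)
          (fun I => (absNorm I : ℝ) ≤ s)).symm)
      rw [mem_nonZeroDivisors_iff_ne_zero]; rfl
    rw [e]
    refine (H s h1).trans ?_
    gcongr
    have := le_abs_self B
    have := abs_nonneg (cK K)
    linarith
  · have : IsEmpty {I : Ideal (𝓞 K) // I ≠ ⊥ ∧ (absNorm I : ℝ) ≤ s} := by
      refine ⟨fun ⟨I, hI, hle⟩ => ?_⟩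
      have h2 : absNorm I ≠ 0 := fun h => hI (absNorm_eq_zero_iff.mp h)
      have : (1:ℝ) ≤ absNorm I := by exact_mod_cast Nat.one_le_iff_ne_zero.mpr h2
      linarith
    rw [Nat.card_of_isEmpty, Nat.cast_zero, zero_sub, abs_neg, abs_mul, abs_of_pos hs]
    have h3 : s ≤ s ^ (1 - 1 / (finrank ℚ K : ℝ)) := by
      conv_lhs => rw [← Real.rpow_one s]
      apply Real.rpow_le_rpow_of_exponent_ge hs h1.le
      have : 0 ≤ 1 / (finrank ℚ K : ℝ) := by positivity
      linarith
    have := abs_nonneg (cK K)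
    have := abs_nonneg B
    calc |cK K| * s ≤ |cK K| * s ^ (1 - 1 / (finrank ℚ K : ℝ)) := by gcongr
      _ ≤ _ := by gcongr; linarith

/-- Nonzero ideals of norm at most `Y` not divisible by any element of `S`. -/
def sieve (S : Finset (Ideal (𝓞 K))) (Y : ℝ) : Set (Ideal (𝓞 K)) :=
  {a | a ≠ ⊥ ∧ (absNorm a : ℝ) ≤ Y ∧ ∀ p ∈ S, ¬ p ∣ a}

theorem sieve_finite (S : Finset (Ideal (𝓞 K))) (Y : ℝ) : (sieve K S Y).Finite := by
  refine (Ideal.finite_setOfPred_absNorm_le (S := 𝓞 K) ⌊Y⌋₊).subset ?_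
  rintro a ⟨-, h, -⟩
  exact Nat.le_floor h

open scoped Classical in
theorem sieve_insert (S : Finset (Ideal (𝓞 K))) (hS : ∀ q ∈ S, Prime q) (p : Ideal (𝓞 K))
    (hp : Prime p) (hpS : p ∉ S) (Y : ℝ) :
    (sieve K S Y).ncard = (sieve K (insert p S) Y).ncard + (sieve K S (Y / absNorm p)).ncard := by
  have hNp : (0:ℝ) < absNorm p := by
    exact_mod_cast Nat.pos_of_ne_zero fun h => hp.ne_zero (absNorm_eq_zero_iff.mp h)
  have hinj : Function.Injective (fun b : Ideal (𝓞 K) => p * b) :=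
    fun a b h => mul_left_cancel₀ hp.ne_zero h
  rw [← Set.ncard_image_of_injective (sieve K S (Y / absNorm p)) hinj,
    ← Set.ncard_union_eq _ (sieve_finite K _ _) ((sieve_finite K _ _).image _)]
  · congr 1
    ext a
    simp only [sieve, Set.mem_union, Set.mem_image, Set.mem_ofPred_eq, Finset.mem_insert]
    constructor
    · rintro ⟨h1, h2, h3⟩
      by_cases hpa : p ∣ a
      · right
        obtain ⟨b, rfl⟩ := hpa
        refine ⟨b, ⟨fun h => h1 (by rw [h, Ideal.mul_bot]), ?_, fun q hq hqb =>
          h3 q hq (hqb.mul_left p)⟩, rfl⟩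
        rw [le_div_iff₀ hNp, mul_comm]
        simpa using h2
      · left
        refine ⟨h1, h2, ?_⟩
        rintro q (rfl | hq)
        · exact hpa
        · exact h3 q hq
    · rintro (⟨h1, h2, h3⟩ | ⟨b, ⟨h1, h2, h3⟩, rfl⟩)
      · exact ⟨h1, h2, fun q hq => h3 q (Or.inr hq)⟩
      · refine ⟨mul_ne_zero hp.ne_zero h1, ?_, fun q hq hqd => ?_⟩
        · rw [le_div_iff₀ hNp, mul_comm] at h2
          simpa using h2
        · rcases (hS q hq).dvd_or_dvd hqd with h | h
          · exact hpS ((associated_iff_eq.mp ((hS q hq).associated_of_dvd hp h)) ▸ hq)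
          · exact h3 q hq h
  · rw [Set.disjoint_left]
    rintro _ ⟨-, -, h⟩ ⟨b, -, rfl⟩
    exact h p (Finset.mem_insert_self _ _) (dvd_mul_right _ _)

theorem sieve_count : ∃ B : ℝ, 0 < B ∧ ∀ S : Finset (Ideal (𝓞 K)), (∀ q ∈ S, Prime q) →
    ∀ Y : ℝ, 0 < Y →
    |((sieve K S Y).ncard : ℝ) - cK K * Y * ∏ p ∈ S, (1 - ((absNorm p : ℝ))⁻¹)| ≤
      B * Y ^ (1 - 1 / (finrank ℚ K : ℝ)) * 2 ^ S.card := by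
  classical
  obtain ⟨B, hB, H⟩ := total_count K
  refine ⟨B, hB, fun S => ?_⟩
  induction S using Finset.induction_on with
  | empty =>
    intro _ Y hY
    have := H Y hY
    have e : (sieve K ∅ Y).ncard =
        Nat.card {I : Ideal (𝓞 K) // I ≠ ⊥ ∧ (absNorm I : ℝ) ≤ Y} := by
      rw [← Nat.card_coe_set_eq]
      exact Nat.card_congr (Equiv.subtypeEquivRight (by simp [sieve]))
    rw [e]
    simpa using this
  | insert p S hpS ih =>
    intro hS Y hY
    have hS' : ∀ q ∈ S, Prime q := fun q hq => hS q (Finset.mem_insert_of_mem hq)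
    have hp : Prime p := hS p (Finset.mem_insert_self _ _)
    have hN1 : (1:ℝ) ≤ absNorm p := by
      exact_mod_cast Nat.one_le_iff_ne_zero.mpr fun h => hp.ne_zero (absNorm_eq_zero_iff.mp h)
    have hN0 : (0:ℝ) < absNorm p := by linarith
    have h1 := ih hS' Y hY
    have h2 := ih hS' (Y / absNorm p) (by positivity)
    have h3 : ((sieve K S Y).ncard : ℝ) = (sieve K (insert p S) Y).ncard +
        (sieve K S (Y / absNorm p)).ncard := by
      exact_mod_cast sieve_insert K S hS' p hp hpS Y
    rw [Finset.prod_insert hpS, Finset.card_insert_of_notMem hpS]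
    have hexp : 0 ≤ 1 - 1 / (finrank ℚ K : ℝ) := by
      have : (1:ℝ) ≤ finrank ℚ K := by exact_mod_cast (finrank_pos : 0 < finrank ℚ K)
      rw [sub_nonneg, div_le_one (by linarith)]
      exact this
    have h4 : (Y / absNorm p) ^ (1 - 1 / (finrank ℚ K : ℝ)) ≤ Y ^ (1 - 1 / (finrank ℚ K : ℝ)) := by
      apply Real.rpow_le_rpow (by positivity) (div_le_self hY.le hN1) hexp
    have h5 : B * (Y / absNorm p) ^ (1 - 1 / (finrank ℚ K : ℝ)) * 2 ^ S.card ≤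
      B * Y ^ (1 - 1 / (finrank ℚ K : ℝ)) * 2 ^ S.card := by gcongr
    have h6 := h2.trans h5
    set P := ∏ q ∈ S, (1 - ((absNorm q : ℝ))⁻¹) with hP
    have e : ((sieve K (insert p S) Y).ncard : ℝ) -
        cK K * Y * ((1 - ((absNorm p : ℝ))⁻¹) * P) =
        (((sieve K S Y).ncard : ℝ) - cK K * Y * P) -
        (((sieve K S (Y / absNorm p)).ncard : ℝ) - cK K * (Y / absNorm p) * P) := by
      rw [h3]; field_simp; ring
    rw [e, pow_succ]
    refine (abs_sub _ _).trans ?_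
    linarith

end Count

/-- Counting ideals coprime to a fixed squarefree ideal `c`. -/
theorem coprime_ideal_count :
    ∃ C : ℝ, 0 < C ∧ ∀ c : Ideal (𝓞 K), c ≠ ⊥ → Squarefree c → ∀ Y : ℝ, 1 ≤ Y →
      |(Nat.card {a : Ideal (𝓞 K) // a ≠ ⊥ ∧ (absNorm a : ℝ) ≤ Y ∧ a ⊔ c = ⊤} : ℝ) -
          cK K * Y * ∏' p : {p : Ideal (𝓞 K) // p.IsPrime ∧ c ≤ p},
            (1 - ((absNorm p.1 : ℝ))⁻¹)| ≤
        C * Y ^ (1 - 1 / (Module.finrank ℚ K : ℝ)) * (absNorm c : ℝ) := by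
  classical
  obtain ⟨B, hB, H⟩ := sieve_count K
  refine ⟨B, hB, fun c hc _ Y hY => ?_⟩
  set S := (UniqueFactorizationMonoid.normalizedFactors c).toFinset with hSdef
  have hmem : ∀ p : Ideal (𝓞 K), p ∈ S ↔ p.IsPrime ∧ c ≤ p := by
    intro p
    rw [hSdef, Multiset.mem_toFinset, Ideal.mem_normalizedFactors_iff hc]
  have hprime : ∀ q ∈ S, Prime q := fun q hq =>
    UniqueFactorizationMonoid.prime_of_normalized_factor q (Multiset.mem_toFinset.mp hq)
  have h1 := H S hprime Y (by linarith)
  have hset : {a : Ideal (𝓞 K) | a ≠ ⊥ ∧ (absNorm a : ℝ) ≤ Y ∧ a ⊔ c = ⊤} = sieve K S Y := by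
    ext a
    simp only [sieve, Set.mem_ofPred_eq]
    refine and_congr_right fun _ => and_congr_right fun _ => ?_
    constructor
    · intro h p hp hpa
      have h2 := (hmem p).mp hp
      have : a ⊔ c ≤ p := sup_le (Ideal.le_of_dvd hpa) h2.2
      rw [h, top_le_iff] at this
      exact h2.1.ne_top this
    · intro h
      by_contra hne
      obtain ⟨m, hm, hle⟩ := Ideal.exists_le_maximal _ hne
      exact h m ((hmem m).mpr ⟨hm.isPrime, le_sup_right.trans hle⟩)
        (Ideal.dvd_iff_le.mpr (le_sup_left.trans hle))
  have hcard : Nat.card {a : Ideal (𝓞 K) // a ≠ ⊥ ∧ (absNorm a : ℝ) ≤ Y ∧ a ⊔ c = ⊤} =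
      (sieve K S Y).ncard := by
    rw [← hset]; rfl
  have hprod : ∏' p : {p : Ideal (𝓞 K) // p.IsPrime ∧ c ≤ p}, (1 - ((absNorm p.1 : ℝ))⁻¹) =
      ∏ p ∈ S, (1 - ((absNorm p : ℝ))⁻¹) := by
    rw [← Finset.tprod_subtype S (fun p : Ideal (𝓞 K) => 1 - ((absNorm p : ℝ))⁻¹)]
    exact ((Equiv.subtypeEquivRight hmem).tprod_eq
      (fun p : {p : Ideal (𝓞 K) // p.IsPrime ∧ c ≤ p} => (1 - ((absNorm p.1 : ℝ))⁻¹))).symm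
  have hnorm : (2:ℝ) ^ S.card ≤ absNorm c := by
    have hdvd : ∏ p ∈ S, p ∣ c := by
      refine Finset.prod_primes_dvd c hprime fun q hq => Ideal.dvd_iff_le.mpr ((hmem q).mp hq).2
    have h2 : absNorm (∏ p ∈ S, p) ≤ absNorm c := by
      refine Nat.le_of_dvd (Nat.pos_of_ne_zero fun h => hc (absNorm_eq_zero_iff.mp h)) ?_
      exact Ideal.absNorm_dvd_absNorm_of_le (Ideal.le_of_dvd hdvd)
    rw [map_prod] at h2
    have h3 : 2 ^ S.card ≤ ∏ p ∈ S, absNorm p := by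
      apply Finset.pow_card_le_prod
      intro p hp
      have a1 : absNorm p ≠ 0 := fun h => (hprime p hp).ne_zero (absNorm_eq_zero_iff.mp h)
      have a2 : absNorm p ≠ 1 := fun h => ((hmem p).mp hp).1.ne_top (absNorm_eq_one_iff.mp h)
      omega
    exact_mod_cast h3.trans h2
  rw [hcard, hprod]
  refine h1.trans ?_
  have : 0 ≤ Y ^ (1 - 1 / (Module.finrank ℚ K : ℝ)) := Real.rpow_nonneg (by linarith) _
  gcongr

end AlladiGen
end
end
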